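/- Let T = {t_1,…,t_m} be a boosted tree ensemble over ℝ^d that is large-spread for the attacker A_{p,k}, with p ∈ ℕ ∪ {∞}, p ≥ 1 or p = ∞, and k > 0, let x ∈ ℝ^d, and for each i in some subset I ⊆ {1,…,m} choose one leaf λ_i ∈ L(t_i,x). Then: if p ≥ 1, ‖∑_{i∈I} dist(x,λ_i)‖_p^p = ∑_{i∈I} ‖dist(x,λ_i)‖_p^p; and ‖∑_{i∈I} dist(x,λ_i)‖₀ = ∑_{i∈I} ‖dist(x,λ_i)‖₀. Hence, for large-spread ensembles, the norm constraint ‖∑_{i,j} z_{ij}·dist(x,λ(s_{ij}))‖_p ≤ k of the optimal-attack optimization problem is equivalent to the additive constraint ∑_{i,j} z_{ij}·‖dist(x,λ(s_{ij}))‖_p^p ≤ k^p (respectively ∑_{i,j} z_{ij}·‖dist(x,λ(s_{ij}))‖₀ ≤ k for p = 0-style counting) whenever at most one leaf per tree is selected. -/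

import Mathlib

/-- The `L_p`-norm of a vector `u ∈ ℝ^d`, for `p ∈ ℕ` with `p ≥ 1` or `p = ∞`
(modeled as `p : ℕ∞`, where `⊤` is `∞`): `‖u‖_∞ = max_c |u c|` and
`‖u‖_p = (∑ c, |u c| ^ p) ^ (1/p)` for finite `p`. -/
noncomputable def pNorm {d : ℕ} (p : ℕ∞) (u : Fin d → ℝ) : ℝ :=
  if p = ⊤ then ⨆ c, |u c|
  else (∑ c, |u c| ^ p.toNat) ^ ((1 : ℝ) / p.toNat)

/-- The `L₀`-norm of `u ∈ ℝ^d`: the number of nonzero coordinates of `u`. -/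
noncomputable def zeroNorm {d : ℕ} (u : Fin d → ℝ) : ℕ :=
  (Finset.univ.filter (fun c => u c ≠ 0)).card

/-- A regression tree over `ℝ^d`: either a leaf `λ(s)` with score `s ∈ ℝ`, or an
internal node `σ(f,v,l,r)` with feature `f`, threshold `v` and subtrees `l`, `r`. -/
inductive RTree (d : ℕ) : Type where
  | leaf (s : ℝ) : RTree d
  | node (f : Fin d) (v : ℝ) (l r : RTree d) : RTree d

/-- `t.hasThreshold f v` holds iff the tree `t` contains an internal node
`σ(f,v,·,·)`, i.e., threshold `v` occurs on feature `f` in `t`. -/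
def RTree.hasThreshold {d : ℕ} : RTree d → Fin d → ℝ → Prop
  | .leaf _, _, _ => False
  | .node f v l r, g, w => (f = g ∧ v = w) ∨ l.hasThreshold g w ∨ r.hasThreshold g w

/-- A hyper-rectangle `∏ i, (lo i, hi i]` with (possibly infinite) extended-real
bounds, annotating a leaf of a decision tree. -/
structure HRect (d : ℕ) where
  lo : Fin d → EReal
  hi : Fin d → EReal

/-- The annotation procedure: the leaves of `t`, each paired with its
hyper-rectangle, starting from the hyper-rectangle `H` at the root. -/
noncomputable def RTree.annotLeaves {d : ℕ} : RTree d → HRect d → List (ℝ × HRect d)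
  | .leaf s, H => [(s, H)]
  | .node f v l r, H =>
      l.annotLeaves ⟨H.lo, fun i => if i = f then min (H.hi i) (v : EReal) else H.hi i⟩ ++
      r.annotLeaves ⟨fun i => if i = f then max (H.lo i) (v : EReal) else H.lo i, H.hi⟩

/-- The annotated leaves of `t`, starting from `(-∞, +∞]^d` at the root; the finite
bounds of each leaf's hyper-rectangle are thresholds of `t` on the corresponding
feature. -/
noncomputable def RTree.leaves {d : ℕ} (t : RTree d) : List (ℝ × HRect d) :=
  t.annotLeaves ⟨fun _ => ⊥, fun _ => ⊤⟩

/-- The minimal adversarial perturbation `dist(x, λ)` pushing `x` into the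
hyper-rectangle `H` annotating a leaf `λ` (with tick `ε`): its `i`-th coordinate is
`0` if `x i ∈ (lo i, hi i]`, `lo i − x i + ε` if `x i ≤ lo i`, and `hi i − x i`
if `x i > hi i`. -/
noncomputable def distLeaf {d : ℕ} (ε : ℝ) (x : Fin d → ℝ) (H : HRect d) : Fin d → ℝ :=
  fun i =>
    if H.lo i < (x i : EReal) ∧ (x i : EReal) ≤ H.hi i then 0
    else if (x i : EReal) ≤ H.lo i then (H.lo i).toReal - x i + ε
    else (H.hi i).toReal - x i

/-- A map vanishing at `0` commutes with a sum having at most one nonzero term. -/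
theorem map_sum_eq_sum_map_of_unique_ne_zero {ι M N : Type*} [AddCommMonoid M] [AddCommMonoid N]
    (g : M → N) (hg : g 0 = 0) (s : Finset ι) (a : ι → M)
    (h : ∀ i ∈ s, ∀ j ∈ s, a i ≠ 0 → a j ≠ 0 → i = j) :
    g (∑ i ∈ s, a i) = ∑ i ∈ s, g (a i) := by
  by_cases hz : ∃ i ∈ s, a i ≠ 0
  · obtain ⟨i, hi, hai⟩ := hz
    have hzero : ∀ j ∈ s, j ≠ i → a j = 0 := fun j hj hji => by
      by_contra haj
      exact hji (h j hj i hi haj hai)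
    rw [Finset.sum_eq_single_of_mem i hi hzero,
      Finset.sum_eq_single_of_mem i hi fun j hj hji => by rw [hzero j hj hji, hg]]
  · push Not at hz
    rw [Finset.sum_eq_zero hz, hg, Finset.sum_eq_zero fun i hi => by rw [hz i hi, hg]]

theorem pNorm_natCast_pow {d q : ℕ} (hq : 1 ≤ q) (u : Fin d → ℝ) :
    pNorm (q : ℕ∞) u ^ q = ∑ c, |u c| ^ q := by
  have hsum : 0 ≤ ∑ c, |u c| ^ q := by positivity
  simp only [pNorm, ENat.natCast_ne_top, if_false, ENat.toNat_natCast, one_div]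
  exact Real.rpow_inv_natCast_pow hsum (by omega)

theorem pNorm_nonneg {d : ℕ} (p : ℕ∞) (u : Fin d → ℝ) : 0 ≤ pNorm p u := by
  unfold pNorm
  split_ifs
  · exact Real.iSup_nonneg fun c => abs_nonneg _
  · positivity

theorem abs_apply_le_pNorm {d : ℕ} {p : ℕ∞} (hp : 1 ≤ p) (u : Fin d → ℝ) (c : Fin d) :
    |u c| ≤ pNorm p u := by
  induction p using ENat.recTopCoe with
  | top =>
    simp only [pNorm, if_true]
    exact le_ciSup (f := fun c => |u c|) (Set.finite_range _).bddAbove c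
  | coe q =>
    have hq : 1 ≤ q := by exact_mod_cast hp
    refine le_of_pow_le_pow_left₀ (by omega : q ≠ 0) (pNorm_nonneg _ u) ?_
    rw [pNorm_natCast_pow hq]
    exact Finset.single_le_sum (f := fun c => |u c| ^ q) (fun _ _ => by positivity)
      (Finset.mem_univ c)

theorem zeroNorm_eq_sum {d : ℕ} (u : Fin d → ℝ) :
    (zeroNorm u : ℝ) = ∑ c, if u c ≠ 0 then (1 : ℝ) else 0 := by
  rw [zeroNorm, Finset.sum_boole]

/-- Bounds of an annotated leaf come from the starting rectangle or from thresholds. -/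
theorem RTree.bounds_of_mem_annotLeaves {d : ℕ} (t : RTree d) (H : HRect d) (l : ℝ × HRect d)
    (hl : l ∈ t.annotLeaves H) (c : Fin d) :
    (l.2.lo c = H.lo c ∨ ∃ v : ℝ, t.hasThreshold c v ∧ l.2.lo c = v) ∧
    (l.2.hi c = H.hi c ∨ ∃ v : ℝ, t.hasThreshold c v ∧ l.2.hi c = v) := by
  induction t generalizing H with
  | leaf s =>
    rw [RTree.annotLeaves, List.mem_singleton] at hl
    subst hl
    exact ⟨.inl rfl, .inl rfl⟩
  | node f v tl tr ihl ihr =>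
    rw [RTree.annotLeaves, List.mem_append] at hl
    simp only [RTree.hasThreshold]
    rcases hl with hl | hl
    · obtain ⟨hlo, hhi⟩ := ihl _ hl
      refine ⟨hlo.imp id fun ⟨w, hw, e⟩ => ⟨w, .inr (.inl hw), e⟩, ?_⟩
      rcases hhi with e | ⟨w, hw, e⟩
      · dsimp only at e
        split_ifs at e with hc
        · rcases min_choice (H.hi c) (v : EReal) with hm | hm
          · exact .inl (e.trans hm)
          · exact .inr ⟨v, .inl ⟨hc.symm, rfl⟩, e.trans hm⟩
        · exact .inl e
      · exact .inr ⟨w, .inr (.inl hw), e⟩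
    · obtain ⟨hlo, hhi⟩ := ihr _ hl
      refine ⟨?_, hhi.imp id fun ⟨w, hw, e⟩ => ⟨w, .inr (.inr hw), e⟩⟩
      rcases hlo with e | ⟨w, hw, e⟩
      · dsimp only at e
        split_ifs at e with hc
        · rcases max_choice (H.lo c) (v : EReal) with hm | hm
          · exact .inl (e.trans hm)
          · exact .inr ⟨v, .inl ⟨hc.symm, rfl⟩, e.trans hm⟩
        · exact .inl e
      · exact .inr ⟨w, .inr (.inr hw), e⟩

/-- A nonzero coordinate of `distLeaf` is at least as large as the distance to some threshold. -/
theorem RTree.exists_hasThreshold_of_distLeaf_ne_zero {d : ℕ} {t : RTree d} {l : ℝ × HRect d}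
    (hl : l ∈ t.leaves) {ε : ℝ} (hε : 0 ≤ ε) {x : Fin d → ℝ} {c : Fin d}
    (hne : distLeaf ε x l.2 c ≠ 0) :
    ∃ v, t.hasThreshold c v ∧ |v - x c| ≤ |distLeaf ε x l.2 c| := by
  obtain ⟨hlo, hhi⟩ := t.bounds_of_mem_annotLeaves _ l hl c
  unfold distLeaf at hne ⊢
  split_ifs at hne ⊢ with hin hle
  · exact absurd rfl hne
  · rcases hlo with e | ⟨v, hv, e⟩
    · simp [e] at hle
    · refine ⟨v, hv, ?_⟩
      rw [e, EReal.coe_le_coe_iff] at hle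
      rw [e, EReal.toReal_coe, abs_of_nonneg (by linarith), abs_of_nonneg (by linarith)]
      linarith
  · rcases hhi with e | ⟨v, hv, e⟩
    · exact absurd ⟨not_le.mp hle, e ▸ le_top⟩ hin
    · exact ⟨v, hv, by rw [e, EReal.toReal_coe]⟩

/-- additivity of the norm of a sum of per-tree minimal perturbations
in a large-spread boosted ensemble `T` (thresholds on the same feature in distinct
trees are more than `2k` apart). For a choice of one leaf `lfs i ∈ L(T i, x)` per
tree `i` in a subset `I ⊆ {1,…,m}`: if `p = q` is finite with `q ≥ 1` then
`‖∑_{i∈I} dist(x, lfs i)‖_p ^ q = ∑_{i∈I} ‖dist(x, lfs i)‖_p ^ q`, and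
`‖∑_{i∈I} dist(x, lfs i)‖₀ = ∑_{i∈I} ‖dist(x, lfs i)‖₀`. Hence the norm
constraint `‖∑ dist‖_p ≤ k` of the optimal-attack optimization problem is
equivalent to the additive constraint `∑ ‖dist‖_p ^ q ≤ k ^ q` (respectively
`∑ ‖dist‖₀ ≤ k` for the `L₀` counting norm). -/
theorem large_spread_norm_constraint_additive
    {d m : ℕ} (p : ℕ∞) (hp : 1 ≤ p) (k : ℝ) (hk : 0 < k) (ε : ℝ) (hε : 0 < ε)
    (T : Fin m → RTree d)
    (hLS : ∀ i j : Fin m, i ≠ j → ∀ f v v',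
      (T i).hasThreshold f v → (T j).hasThreshold f v' → 2 * k < |v - v'|)
    (x : Fin d → ℝ) (I : Finset (Fin m)) (lfs : Fin m → ℝ × HRect d)
    (hlfs : ∀ i ∈ I, lfs i ∈ (T i).leaves ∧ pNorm p (distLeaf ε x (lfs i).2) ≤ k) :
    (∀ q : ℕ, 1 ≤ q → p = (q : ℕ∞) →
      (pNorm p (∑ i ∈ I, distLeaf ε x (lfs i).2) ^ q =
        ∑ i ∈ I, pNorm p (distLeaf ε x (lfs i).2) ^ q) ∧
      (pNorm p (∑ i ∈ I, distLeaf ε x (lfs i).2) ≤ k ↔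
        ∑ i ∈ I, pNorm p (distLeaf ε x (lfs i).2) ^ q ≤ k ^ q)) ∧
    ((zeroNorm (∑ i ∈ I, distLeaf ε x (lfs i).2) : ℝ) =
        ∑ i ∈ I, (zeroNorm (distLeaf ε x (lfs i).2) : ℝ)) ∧
    ((zeroNorm (∑ i ∈ I, distLeaf ε x (lfs i).2) : ℝ) ≤ k ↔
        ∑ i ∈ I, (zeroNorm (distLeaf ε x (lfs i).2) : ℝ) ≤ k) := by
  have huniq : ∀ c, ∀ i ∈ I, ∀ j ∈ I, distLeaf ε x (lfs i).2 c ≠ 0 →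
      distLeaf ε x (lfs j).2 c ≠ 0 → i = j := by
    intro c i hi j hj hci hcj
    by_contra hij
    obtain ⟨v, hv, hvx⟩ := RTree.exists_hasThreshold_of_distLeaf_ne_zero (hlfs i hi).1 hε.le hci
    obtain ⟨w, hw, hwx⟩ := RTree.exists_hasThreshold_of_distLeaf_ne_zero (hlfs j hj).1 hε.le hcj
    have hvk := hvx.trans ((abs_apply_le_pNorm hp _ c).trans (hlfs i hi).2)
    have hwk := hwx.trans ((abs_apply_le_pNorm hp _ c).trans (hlfs j hj).2)
    have hspread := hLS i j hij c v w hv hw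
    have htri := abs_sub_le v (x c) w
    rw [abs_sub_comm (x c) w] at htri
    linarith
  have hzero : (zeroNorm (∑ i ∈ I, distLeaf ε x (lfs i).2) : ℝ) =
      ∑ i ∈ I, (zeroNorm (distLeaf ε x (lfs i).2) : ℝ) := by
    simp only [zeroNorm_eq_sum, Finset.sum_apply]
    rw [Finset.sum_comm]
    exact Finset.sum_congr rfl fun c _ => map_sum_eq_sum_map_of_unique_ne_zero
      (fun y : ℝ => if y ≠ 0 then (1 : ℝ) else 0) (by simp) I _ (huniq c)
  refine ⟨?_, hzero, by rw [hzero]⟩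
  rintro q hq rfl
  have hpow : pNorm q (∑ i ∈ I, distLeaf ε x (lfs i).2) ^ q =
      ∑ i ∈ I, pNorm q (distLeaf ε x (lfs i).2) ^ q := by
    simp only [pNorm_natCast_pow hq, Finset.sum_apply]
    rw [Finset.sum_comm]
    exact Finset.sum_congr rfl fun c _ => map_sum_eq_sum_map_of_unique_ne_zero
      (fun y : ℝ => |y| ^ q) (by simp; omega) I _ (huniq c)
  refine ⟨hpow, ?_⟩
  rw [← hpow]
  exact (pow_le_pow_iff_left₀ (pNorm_nonneg _ _) hk.le (by omega)).symm
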